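/- arXiv:2411.02721 — 2 statements merged into one kernel-verified Lean document; each statement's English description precedes it below -/
import Mathlib

section
/- Suppose x̄ is a 𝔷-uniform Slater point and g satisfies the exponential growth condition at x̄. Then there exists ε > 0 such that for all (x, v, c) ∈ B_ε(x̄) × S^{m−1} × 𝒞, the function x' ↦ e_c(x', v) is continuously differentiable at x, with gradient ∇_x e_c(x, v) = χ(ρ_c(x,v)) ∇_x ρ_c(x,v) if (v, c) ∈ F(x), and ∇_x e_c(x, v) = 0 if (v, c) ∈ I(x). -/
open MeasureTheory Real Set
open scoped InnerProductSpace ENNReal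

noncomputable section

/-- The density of the chi distribution with `m` degrees of freedom. -/
def chiPDF (m : ℕ) (r : ℝ) : ℝ :=
  (2 ^ (1 - (m : ℝ) / 2) / Real.Gamma ((m : ℝ) / 2)) * r ^ (m - 1) * Real.exp (-r ^ 2 / 2)

/-- Matrix applied to a Euclidean vector. -/
def mApp {m : ℕ} (A : Matrix (Fin m) (Fin m) ℝ) (v : EuclideanSpace ℝ (Fin m)) :
    EuclideanSpace ℝ (Fin m) :=
  Matrix.toEuclideanLin A v

/-- The set `{r ≥ 0 : g(x, r·𝔏(c)v + 𝔷(c)) ≤ 0}`. -/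
def radialSet {n m p : ℕ} (g : EuclideanSpace ℝ (Fin n) → EuclideanSpace ℝ (Fin m) → ℝ)
    (z : EuclideanSpace ℝ (Fin p) → EuclideanSpace ℝ (Fin m))
    (L : EuclideanSpace ℝ (Fin p) → Matrix (Fin m) (Fin m) ℝ)
    (c : EuclideanSpace ℝ (Fin p)) (x : EuclideanSpace ℝ (Fin n))
    (v : EuclideanSpace ℝ (Fin m)) : Set ℝ :=
  {r : ℝ | 0 ≤ r ∧ g x (r • mApp (L c) v + z c) ≤ 0}

/-- The parametric radial probability function `e_c(x, v)`. -/
def radialE {n m p : ℕ} (g : EuclideanSpace ℝ (Fin n) → EuclideanSpace ℝ (Fin m) → ℝ)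
    (z : EuclideanSpace ℝ (Fin p) → EuclideanSpace ℝ (Fin m))
    (L : EuclideanSpace ℝ (Fin p) → Matrix (Fin m) (Fin m) ℝ)
    (c : EuclideanSpace ℝ (Fin p)) (x : EuclideanSpace ℝ (Fin n))
    (v : EuclideanSpace ℝ (Fin m)) : ℝ :=
  ∫ r in radialSet g z L c x v, chiPDF m r

/-- The radius function `ρ_c(x, v) ∈ [0, ∞]`,
the supremum of `{r ≥ 0 : g(x, r·𝔏(c)v + 𝔷(c)) ≤ 0}`. -/
def rho {n m p : ℕ} (g : EuclideanSpace ℝ (Fin n) → EuclideanSpace ℝ (Fin m) → ℝ)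
    (z : EuclideanSpace ℝ (Fin p) → EuclideanSpace ℝ (Fin m))
    (L : EuclideanSpace ℝ (Fin p) → Matrix (Fin m) (Fin m) ℝ)
    (c : EuclideanSpace ℝ (Fin p)) (x : EuclideanSpace ℝ (Fin n))
    (v : EuclideanSpace ℝ (Fin m)) : ℝ≥0∞ :=
  sSup (ENNReal.ofReal '' radialSet g z L c x v)

section Aux
open Filter Topology

theorem cvx_ineq {f : ℝ → ℝ} (hf : ConvexOn ℝ univ f) {s t : ℝ} (hs : 0 ≤ s) (hst : s ≤ t)
    (ht : 0 < t) : t * f s ≤ (t - s) * f 0 + s * f t := by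
  have ha : 0 ≤ (t - s) / t := div_nonneg (by linarith) ht.le
  have hb : 0 ≤ s / t := div_nonneg hs ht.le
  have hab : (t - s) / t + s / t = 1 := by field_simp; ring
  have h := hf.2 (mem_univ (0:ℝ)) (mem_univ t) ha hb hab
  have e : ((t - s) / t) • (0:ℝ) + (s / t) • t = s := by
    simp only [smul_eq_mul]; field_simp; ring
  rw [e] at h
  simp only [smul_eq_mul] at h
  have := mul_le_mul_of_nonneg_left h ht.le
  calc t * f s ≤ _ := this
    _ = _ := by field_simp

theorem cvx_neg {f : ℝ → ℝ} (hf : ConvexOn ℝ univ f) (h0 : f 0 < 0) {ρ r : ℝ} (hρ : 0 < ρ)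
    (hz : f ρ ≤ 0) (hr : 0 ≤ r) (hrρ : r < ρ) : f r < 0 := by
  have := cvx_ineq hf hr hrρ.le hρ
  by_contra hc
  push Not at hc
  nlinarith [mul_pos (sub_pos.2 hrρ) (neg_pos.2 h0), mul_nonneg hρ.le hc, mul_nonneg hr (neg_nonneg.2 hz)]

theorem cvx_pos {f : ℝ → ℝ} (hf : ConvexOn ℝ univ f) (h0 : f 0 < 0) {ρ r : ℝ} (hρ : 0 < ρ)
    (hz : f ρ = 0) (hrρ : ρ < r) : 0 < f r := by
  by_contra hc
  push Not at hc
  have := cvx_neg hf h0 (hρ.trans hrρ) hc hρ.le hrρ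
  linarith

theorem cvx_bdd {f : ℝ → ℝ} (hf : ConvexOn ℝ univ f) (hb : ∀ r > 0, f r ≤ 0) {r : ℝ} (hr : 0 ≤ r) :
    f r ≤ f 0 := by
  rcases hr.eq_or_lt with h | hr
  · rw [← h]
  by_contra hc
  push Not at hc
  set d := f r - f 0 with hd
  have hd0 : 0 < d := by linarith
  obtain ⟨k, hk⟩ := exists_nat_gt (max 1 (-f 0 / d))
  have h1 : (1:ℝ) < k := lt_of_le_of_lt (le_max_left _ _) hk
  have h2 : -f 0 / d < k := lt_of_le_of_lt (le_max_right _ _) hk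
  rw [div_lt_iff₀ hd0] at h2
  have h3 := cvx_ineq hf hr.le (t := k * r) (by nlinarith) (by positivity)
  have h4 := hb (k * r) (by positivity)
  have h5 : k * f r ≤ (k - 1) * f 0 + f (k * r) := by
    have : r * (k * f r) ≤ r * ((k - 1) * f 0 + f (k * r)) := by nlinarith
    exact le_of_mul_le_mul_left this hr
  nlinarith

theorem set_eq_Icc {f : ℝ → ℝ} (hf : ConvexOn ℝ univ f) (h0 : f 0 < 0) {ρ : ℝ} (hρ : 0 < ρ)
    (hz : f ρ = 0) : {r : ℝ | 0 ≤ r ∧ f r ≤ 0} = Icc 0 ρ := by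
  ext r
  simp only [mem_ofPred_eq, mem_Icc, and_congr_right_iff]
  intro hr
  constructor
  · intro h
    by_contra hc
    push Not at hc
    linarith [cvx_pos hf h0 hρ hz hc]
  · intro h
    rcases h.eq_or_lt with h | h
    · rw [h, hz]
    · exact (cvx_neg hf h0 hρ hz.le hr h).le

theorem sup_Icc {ρ : ℝ} (hρ : 0 < ρ) : (sSup (ENNReal.ofReal '' Icc 0 ρ)).toReal = ρ := by
  have : IsGreatest (ENNReal.ofReal '' Icc 0 ρ) (ENNReal.ofReal ρ) := by
    refine ⟨⟨ρ, ⟨hρ.le, le_rfl⟩, rfl⟩, ?_⟩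
    rintro _ ⟨r, hr, rfl⟩
    exact ENNReal.ofReal_le_ofReal hr.2
  rw [this.csSup_eq, ENNReal.toReal_ofReal hρ.le]

theorem exists_root {f : ℝ → ℝ} (hc : Continuous f) (h0 : f 0 < 0) (hr : ∃ r > 0, 0 < f r) :
    ∃ ρ > 0, f ρ = 0 := by
  obtain ⟨r, hr0, hr⟩ := hr
  obtain ⟨ρ, hρ, h⟩ := intermediate_value_Icc hr0.le hc.continuousOn (show (0:ℝ) ∈ Icc (f 0) (f r) from ⟨h0.le, hr.le⟩)
  refine ⟨ρ, lt_of_le_of_ne hρ.1 ?_, h⟩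
  rintro rfl
  linarith

theorem tail_facts {χ : ℝ → ℝ} (hχc : Continuous χ) (hχ0 : ∀ r, 0 ≤ r → 0 ≤ χ r)
    (hχ : ∀ B : ℝ, Tendsto (fun r => χ r * exp (B * r)) atTop (𝓝 0)) :
    (∀ B : ℝ, IntegrableOn (fun r => χ r * exp (B * r)) (Ioi 0)) ∧
    (∀ B : ℝ, 0 ≤ B → Tendsto (fun r => (∫ s in Ioi r, χ s) * exp (B * r)) atTop (𝓝 0)) ∧
    (∀ B : ℝ, Tendsto (fun r => χ r * (exp (B * r) * r)) atTop (𝓝 0)) := by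
  have hI : ∀ B : ℝ, IntegrableOn (fun r => χ r * exp (B * r)) (Ioi 0) := by
    intro B
    refine integrable_of_isBigO_exp_neg (b := 1) one_pos (by fun_prop) ?_
    have h1 := (hχ (B + 1)).isBigO_one ℝ
    have h2 := h1.mul (Asymptotics.isBigO_refl (fun r : ℝ => exp (-1 * r)) atTop)
    refine (h2.congr ?_ ?_)
    · intro r
      rw [mul_assoc, ← Real.exp_add]; ring_nf
    · intro r; simp
  refine ⟨hI, ?_, ?_⟩
  · intro B hB
    have hI0 : IntegrableOn χ (Ioi 0) := by simpa using hI 0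
    have ht : Tendsto (fun r : ℝ => ∫ s in Ioi r, χ s * exp (B * s)) atTop (𝓝 0) := by
      have h1 := intervalIntegral_tendsto_integral_Ioi 0 (hI B) tendsto_id
      have h2 := (tendsto_const_nhds (x := ∫ s in Ioi 0, χ s * exp (B * s))).sub h1
      rw [sub_self] at h2
      refine h2.congr' ?_
      filter_upwards [eventually_ge_atTop 0] with r hr
      have := intervalIntegral.integral_interval_add_Ioi (hI B) ((hI B).mono_set (Ioi_subset_Ioi hr))
      simp only [id]
      linarith
    refine squeeze_zero' ?_ ?_ ht
    · filter_upwards [eventually_ge_atTop 0] with r hr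
      refine mul_nonneg (setIntegral_nonneg measurableSet_Ioi fun s hs => hχ0 s (hr.trans (le_of_lt hs))) (exp_pos _).le
    · filter_upwards [eventually_ge_atTop 0] with r hr
      rw [← integral_mul_const]
      refine setIntegral_mono_on ((hI0.mono_set (Ioi_subset_Ioi hr)).mul_const _) ((hI B).mono_set (Ioi_subset_Ioi hr)) measurableSet_Ioi ?_
      intro s hs
      have hs' : r < s := hs
      refine mul_le_mul_of_nonneg_left (exp_le_exp.2 (by nlinarith)) (hχ0 s (hr.trans hs'.le))
  · intro B
    have h1 := tendsto_pow_mul_exp_neg_atTop_nhds_zero 1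
    have h2 := (hχ (B + 1)).mul h1
    rw [mul_zero] at h2
    refine h2.congr fun r => ?_
    have : exp ((B+1) * r) * exp (-r) = exp (B * r) := by rw [← exp_add]; ring_nf
    rw [← this]; ring

theorem chi_facts {m : ℕ} (hm : 0 < m) : Continuous (chiPDF m) ∧ (∀ r, 0 ≤ r → 0 ≤ chiPDF m r) ∧
    ∀ B : ℝ, Tendsto (fun r => chiPDF m r * exp (B * r)) atTop (𝓝 0) := by
  refine ⟨by unfold chiPDF; fun_prop, ?_, ?_⟩
  · intro r hr
    unfold chiPDF
    have : 0 < Real.Gamma ((m:ℝ)/2) := Real.Gamma_pos_of_pos (by positivity)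
    positivity
  · intro B
    set K : ℝ := (2 ^ (1 - (m : ℝ) / 2) / Real.Gamma ((m : ℝ) / 2)) with hK
    have h1 := (tendsto_pow_mul_exp_neg_atTop_nhds_zero (m - 1)).const_mul (|K| * exp ((B+1)^2/2))
    rw [mul_zero] at h1
    refine squeeze_zero_norm' ?_ h1
    filter_upwards [eventually_ge_atTop 0] with r hr
    unfold chiPDF
    rw [← hK]
    rw [norm_mul, norm_mul, norm_mul, norm_of_nonneg (exp_pos _).le, norm_of_nonneg (exp_pos _).le, norm_of_nonneg (pow_nonneg hr _), Real.norm_eq_abs]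
    have : exp (-r^2/2) * exp (B * r) ≤ exp ((B+1)^2/2) * exp (-r) := by
      rw [← exp_add, ← exp_add]
      apply exp_le_exp.2
      nlinarith [sq_nonneg (r - (B+1))]
    calc _ = |K| * r^(m-1) * (exp (-r^2/2) * exp (B * r)) := by ring
      _ ≤ |K| * r^(m-1) * (exp ((B+1)^2/2) * exp (-r)) := by gcongr
      _ = _ := by ring

theorem implicit_radius {E : Type*} [NormedAddCommGroup E] [NormedSpace ℝ E] [CompleteSpace E]
    {h : E → ℝ → ℝ} (hh : ContDiff ℝ 1 (Function.uncurry h))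
    (hcv : ∀ x, ConvexOn ℝ univ (h x)) {x0 : E} {γ ρ M : ℝ} (hγ : 0 < γ) (h0 : h x0 0 < -γ)
    (hρ : 0 < ρ) (hz : h x0 ρ = 0) (hM : ‖fderiv ℝ (fun x => h x ρ) x0‖ ≤ M) :
    ∃ φ : E → ℝ, φ x0 = ρ ∧ ContDiffAt ℝ 1 φ x0 ∧
      (∀ᶠ x in 𝓝 x0, 0 < φ x ∧ h x 0 < 0 ∧ h x (φ x) = 0) ∧ ‖fderiv ℝ φ x0‖ ≤ M * ρ / γ := by
  have hd : HasFDerivAt (Function.uncurry h) (fderiv ℝ (Function.uncurry h) (x0, ρ)) (x0, ρ) :=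
    (hh.differentiable one_ne_zero _).hasFDerivAt
  set D := fderiv ℝ (Function.uncurry h) (x0, ρ) with hD
  set s := D (0, 1) with hs
  have hder : HasDerivAt (h x0) s ρ := by
    have h1 : HasDerivAt (fun r : ℝ => (x0, r)) ((0 : E), (1 : ℝ)) ρ :=
      (hasDerivAt_const ρ x0).prodMk (hasDerivAt_id ρ)
    exact hd.comp_hasDerivAt ρ h1
  have hdx : HasFDerivAt (fun x => h x ρ) (D ∘L .inl ℝ E ℝ) x0 := by
    have h1 : HasFDerivAt (fun x : E => (x, ρ)) (ContinuousLinearMap.inl ℝ E ℝ) x0 :=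
      hasFDerivAt_prodMk_left x0 ρ
    exact HasFDerivAt.comp (g := Function.uncurry h) x0 hd h1
  rw [hdx.fderiv] at hM
  have hsl : γ / ρ ≤ s := by
    have := (hcv x0).slope_le_of_hasDerivAt (mem_univ 0) (mem_univ ρ) hρ hder
    rw [slope_def_field, hz] at this
    refine le_trans ?_ this
    rw [sub_zero]
    gcongr
    linarith
  have hs0 : 0 < s := lt_of_lt_of_le (by positivity) hsl
  have hinv : (D ∘L .inr ℝ E ℝ).IsInvertible := by
    refine ⟨ContinuousLinearEquiv.unitsEquivAut ℝ (Units.mk0 s hs0.ne'), ?_⟩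
    ext
    simp [hs]
  have cd : ContDiffAt ℝ 1 (Function.uncurry h) (x0, ρ) := hh.contDiffAt
  set φ := cd.implicitFunction one_ne_zero hinv with hφ
  have e1 : φ x0 = ρ := cd.implicitFunction_apply_self one_ne_zero hinv
  have e2 : ContDiffAt ℝ 1 φ x0 := cd.contDiffAt_implicitFunction one_ne_zero hinv
  have e3 : ∀ᶠ x in 𝓝 x0, h x (φ x) = 0 := by
    have := cd.eventually_apply_implicitFunction one_ne_zero hinv
    filter_upwards [this] with x hx
    rw [← hz]; exact hx
  refine ⟨φ, e1, e2, ?_, ?_⟩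
  · have c1 : ∀ᶠ x in 𝓝 x0, 0 < φ x := by
      apply e2.continuousAt.eventually_const_lt
      rw [e1]; exact hρ
    have c2 : ∀ᶠ x in 𝓝 x0, h x 0 < 0 := by
      have : Continuous (fun x => h x 0) :=
        hh.continuous.comp (continuous_id.prodMk continuous_const)
      exact this.continuousAt.eventually_lt_const (by linarith)
    filter_upwards [c1, c2, e3] with x a b c using ⟨a, b, c⟩
  · have hM0 : 0 ≤ M := (norm_nonneg _).trans hM
    refine ContinuousLinearMap.opNorm_le_bound _ (by positivity) fun u => ?_
    have hφd : HasFDerivAt φ (fderiv ℝ φ x0) x0 :=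
      (e2.differentiableAt one_ne_zero).hasFDerivAt
    have hcomp : HasFDerivAt (fun x => h x (φ x))
        (D ∘L ((ContinuousLinearMap.id ℝ E).prod (fderiv ℝ φ x0))) x0 := by
      have h1 := (hasFDerivAt_id x0).prodMk hφd
      have h2 : HasFDerivAt (Function.uncurry h) D (id x0, φ x0) := by
        rw [e1]; exact hd
      exact HasFDerivAt.comp (g := Function.uncurry h) x0 h2 h1
    have hzero : HasFDerivAt (fun x => h x (φ x)) (0 : E →L[ℝ] ℝ) x0 :=
      (hasFDerivAt_const (0:ℝ) x0).congr_of_eventuallyEq e3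
    have heq := congrArg (fun T : E →L[ℝ] ℝ => T u) (hcomp.unique hzero)
    have heq' : D (u, 0) + fderiv ℝ φ x0 u * s = 0 := by
      have : D (u, fderiv ℝ φ x0 u) = 0 := by simpa using heq
      rw [hs, ← smul_eq_mul, ← map_smul, ← map_add]
      simpa using this
    have hb : |D (u, 0)| ≤ M * ‖u‖ := by
      have := (D ∘L .inl ℝ E ℝ).le_of_opNorm_le hM u
      simpa using this
    have h4 : |fderiv ℝ φ x0 u| * s ≤ M * ‖u‖ := by
      have : |D (u,0)| = |fderiv ℝ φ x0 u| * s := by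
        rw [eq_neg_of_add_eq_zero_left heq', abs_neg, abs_mul, abs_of_pos hs0]
      linarith
    have h5 : |fderiv ℝ φ x0 u| * (γ / ρ) ≤ M * ‖u‖ :=
      le_trans (mul_le_mul_of_nonneg_left hsl (abs_nonneg _)) h4
    rw [Real.norm_eq_abs]
    calc |fderiv ℝ φ x0 u| = |fderiv ℝ φ x0 u| * (γ / ρ) * (ρ / γ) := by field_simp
      _ ≤ M * ‖u‖ * (ρ / γ) := by gcongr
      _ = _ := by ring

theorem finite_case {E : Type*} [NormedAddCommGroup E] [NormedSpace ℝ E] [CompleteSpace E]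
    {h : E → ℝ → ℝ} (hh : ContDiff ℝ 1 (Function.uncurry h))
    (hcv : ∀ x, ConvexOn ℝ univ (h x)) {x0 : E} {γ ρ M : ℝ} (hγ : 0 < γ) (h0 : h x0 0 < -γ)
    (hρ : 0 < ρ) (hz : h x0 ρ = 0) (hM : ‖fderiv ℝ (fun x => h x ρ) x0‖ ≤ M)
    {χ : ℝ → ℝ} (hχc : Continuous χ) (hχ0 : ∀ r, 0 ≤ r → 0 ≤ χ r) {R e : E → ℝ}
    (hR : ∀ x, R x = (sSup (ENNReal.ofReal '' {r : ℝ | 0 ≤ r ∧ h x r ≤ 0})).toReal)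
    (he : ∀ x, e x = ∫ r in {r : ℝ | 0 ≤ r ∧ h x r ≤ 0}, χ r) :
    ContDiffAt ℝ 1 e x0 ∧ fderiv ℝ e x0 = χ (R x0) • fderiv ℝ R x0 ∧
      ‖fderiv ℝ e x0‖ ≤ χ ρ * (M * ρ / γ) := by
  obtain ⟨φ, e1, e2, e3, e4⟩ := implicit_radius hh hcv hγ h0 hρ hz hM
  have hRφ : R =ᶠ[𝓝 x0] φ := by
    filter_upwards [e3] with x hx
    rw [hR, set_eq_Icc (hcv x) hx.2.1 hx.1 hx.2.2, sup_Icc hx.1]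
  set G : ℝ → ℝ := fun t => ∫ r in (0:ℝ)..t, χ r with hG
  have heφ : e =ᶠ[𝓝 x0] fun x => G (φ x) := by
    filter_upwards [e3] with x hx
    rw [he, set_eq_Icc (hcv x) hx.2.1 hx.1 hx.2.2, integral_Icc_eq_integral_Ioc, hG]
    simp only
    rw [intervalIntegral.integral_of_le hx.1.le]
  have hGd : ∀ t, HasDerivAt G (χ t) t := fun t =>
    intervalIntegral.integral_hasDerivAt_right (hχc.intervalIntegrable _ _)
      (hχc.stronglyMeasurableAtFilter _ _) hχc.continuousAt
  have hGc : ContDiff ℝ 1 G := by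
    rw [contDiff_one_iff_deriv]
    refine ⟨fun t => (hGd t).differentiableAt, ?_⟩
    have : deriv G = χ := funext fun t => (hGd t).deriv
    rw [this]; exact hχc
  have hφd : HasFDerivAt φ (fderiv ℝ φ x0) x0 := (e2.differentiableAt one_ne_zero).hasFDerivAt
  have hed : fderiv ℝ e x0 = χ ρ • fderiv ℝ φ x0 := by
    rw [heφ.fderiv_eq]
    have := (hGd (φ x0)).comp_hasFDerivAt x0 hφd
    rw [e1] at this
    exact this.fderiv
  have hR0 : R x0 = ρ := by rw [hRφ.eq_of_nhds, e1]
  refine ⟨?_, ?_, ?_⟩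
  · exact (ContDiffAt.comp x0 hGc.contDiffAt e2).congr_of_eventuallyEq heφ
  · rw [hR0, hRφ.fderiv_eq, hed]
  · rw [hed, norm_smul, Real.norm_eq_abs, abs_of_nonneg (hχ0 ρ hρ.le)]
    exact mul_le_mul_of_nonneg_left e4 (hχ0 ρ hρ.le)

theorem main_abs {E : Type*} [NormedAddCommGroup E] [NormedSpace ℝ E] [CompleteSpace E]
    {h : E → ℝ → ℝ} (hh : ContDiff ℝ 1 (Function.uncurry h))
    (hcv : ∀ x, ConvexOn ℝ univ (h x)) {xb : E} {ε γ A B : ℝ} (hγ : 0 < γ) (hA : 0 < A)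
    (hB : 0 ≤ B)
    (h0 : ∀ x ∈ Metric.ball xb ε, h x 0 < -γ)
    (hgr : ∀ x ∈ Metric.ball xb ε, ∀ r, 0 ≤ r → ‖fderiv ℝ (fun x => h x r) x‖ ≤ A * exp (B * r))
    {χ : ℝ → ℝ} (hχc : Continuous χ) (hχ0 : ∀ r, 0 ≤ r → 0 ≤ χ r)
    (hχ : ∀ B : ℝ, Tendsto (fun r => χ r * exp (B * r)) atTop (𝓝 0)) {R e : E → ℝ}
    (hR : ∀ x, R x = (sSup (ENNReal.ofReal '' {r : ℝ | 0 ≤ r ∧ h x r ≤ 0})).toReal)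
    (he : ∀ x, e x = ∫ r in {r : ℝ | 0 ≤ r ∧ h x r ≤ 0}, χ r)
    {x : E} (hx : x ∈ Metric.ball xb ε) :
    ContDiffAt ℝ 1 e x ∧ ((∃ r > 0, 0 < h x r) → fderiv ℝ e x = χ (R x) • fderiv ℝ R x) ∧
      ((∀ r > 0, h x r ≤ 0) → fderiv ℝ e x = 0) := by
  obtain ⟨hI, hT, hχB⟩ := tail_facts hχc hχ0 hχ
  have hI0 : IntegrableOn χ (Ioi 0) := by simpa using hI 0
  have hcr : ∀ x, Continuous (h x) := fun x => hh.continuous.comp (continuous_const.prodMk continuous_id)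
  have hcx : ∀ r, Continuous (fun x => h x r) := fun r => hh.continuous.comp (continuous_id.prodMk continuous_const)
  have hdx : ∀ r, Differentiable ℝ (fun x => h x r) := fun r =>
    (hh.comp (contDiff_id.prodMk contDiff_const)).differentiable one_ne_zero
  have hneg : ∀ x ∈ Metric.ball xb ε, h x 0 < 0 := fun x hx => by linarith [h0 x hx]
  have fin : ∀ x ∈ Metric.ball xb ε, ∀ ρ > 0, h x ρ = 0 →
      ContDiffAt ℝ 1 e x ∧ fderiv ℝ e x = χ (R x) • fderiv ℝ R x ∧
      ‖fderiv ℝ e x‖ ≤ χ ρ * (A * exp (B * ρ) * ρ / γ) := fun x hx ρ hρ hz =>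
    finite_case hh hcv hγ (h0 x hx) hρ hz (hgr x hx ρ hρ.le) hχc hχ0 hR he
  -- roots are far away near an infinite point
  have far : ∀ x ∈ Metric.ball xb ε, (∀ r > 0, h x r ≤ 0) → ∀ K : ℝ, ∀ᶠ y in 𝓝 x,
      y ∈ Metric.ball xb ε ∧ ∀ ρ > 0, h y ρ = 0 → K < ρ := by
    intro x hx hinf K
    have h1 : h x (max K 1) < 0 :=
      lt_of_le_of_lt (cvx_bdd (hcv x) hinf (by positivity)) (hneg x hx)
    filter_upwards [Metric.isOpen_ball.mem_nhds hx, (hcx _).continuousAt.eventually_lt_const h1] with y hy1 hy2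
    refine ⟨hy1, fun ρ hρ hz => ?_⟩
    by_contra hc
    push Not at hc
    rcases (hc.trans (le_max_left K 1)).eq_or_lt with h | h
    · rw [← h] at hy2; linarith
    · linarith [cvx_pos (hcv y) (hneg y hy1) hρ hz h]
  have einf : ∀ x ∈ Metric.ball xb ε, (∀ r > 0, h x r ≤ 0) → e x = ∫ r in Ioi 0, χ r := by
    intro x hx hinf
    rw [he, ← integral_Ici_eq_integral_Ioi]
    congr 2
    ext r
    simp only [mem_ofPred_eq, mem_Ici, and_iff_left_iff_imp]
    intro hr
    exact (cvx_bdd (hcv x) hinf hr).trans (hneg x hx).le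
  have efin : ∀ x ∈ Metric.ball xb ε, ∀ ρ > 0, h x ρ = 0 →
      (∫ r in Ioi 0, χ r) - e x = ∫ r in Ioi ρ, χ r := by
    intro x hx ρ hρ hz
    rw [he, set_eq_Icc (hcv x) (hneg x hx) hρ hz, integral_Icc_eq_integral_Ioc,
      ← intervalIntegral.integral_of_le hρ.le]
    have := intervalIntegral.integral_interval_add_Ioi hI0 (hI0.mono_set (Ioi_subset_Ioi hρ.le))
    linarith
  have root : ∀ x ∈ Metric.ball xb ε, (∀ r > 0, h x r ≤ 0) ∨ ∃ ρ > 0, h x ρ = 0 := by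
    intro x hx
    by_cases hc : ∃ r > 0, 0 < h x r
    · exact Or.inr (exists_root (hcr x) (hneg x hx) hc)
    · push Not at hc
      exact Or.inl hc
  have inf : ∀ x ∈ Metric.ball xb ε, (∀ r > 0, h x r ≤ 0) → HasFDerivAt e (0 : E →L[ℝ] ℝ) x := by
    intro x hx hinf
    rw [hasFDerivAt_iff_isLittleO, Asymptotics.isLittleO_iff]
    intro δ hδ
    have hsm := (hT B hB).eventually_lt_const (show 0 < δ * γ / A by positivity)
    obtain ⟨K, hK⟩ := eventually_atTop.1 hsm
    filter_upwards [far x hx hinf K] with y hy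
    obtain ⟨hyb, hy⟩ := hy
    simp only [ContinuousLinearMap.zero_apply, sub_zero]
    rcases root y hyb with hc | ⟨ρ, hρ, hz⟩
    · rw [einf x hx hinf, einf y hyb hc, sub_self, norm_zero]; positivity
    · have hKρ := hK ρ (hy ρ hρ hz).le
      have hT0 : 0 ≤ ∫ s in Ioi ρ, χ s :=
        setIntegral_nonneg measurableSet_Ioi fun s hs => hχ0 s (hρ.le.trans (le_of_lt hs))
      have e1 : ‖e y - e x‖ = ∫ s in Ioi ρ, χ s := by
        rw [einf x hx hinf, norm_sub_rev, efin y hyb ρ hρ hz, Real.norm_eq_abs, abs_of_nonneg hT0]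
      have e2 : γ ≤ A * exp (B * ρ) * ‖y - x‖ := by
        have := (convex_ball xb ε).norm_image_sub_le_of_norm_fderiv_le (𝕜 := ℝ)
          (f := fun x => h x ρ) (fun z _ => hdx ρ z) (fun z hz => hgr z hz ρ hρ.le) hx hyb
        refine le_trans ?_ this
        rw [hz, Real.norm_eq_abs]
        refine le_trans ?_ (le_abs_self _)
        linarith [cvx_bdd (hcv x) hinf hρ.le, h0 x hx]
      rw [e1]
      set T := ∫ s in Ioi ρ, χ s
      set X := exp (B * ρ) with hX
      have hXp : 0 < X := exp_pos _
      have h6 : T * X ≤ δ * ‖y - x‖ * X := by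
        refine hKρ.le.trans ?_
        rw [div_le_iff₀ hA]
        calc δ * γ ≤ δ * (A * X * ‖y - x‖) := by gcongr
          _ = _ := by ring
      exact le_of_mul_le_mul_right h6 hXp
  refine ⟨?_, ?_, fun hinf => (inf x hx hinf).fderiv⟩
  · rw [contDiffAt_one_iff]
    refine ⟨fderiv ℝ e, Metric.ball xb ε, Metric.isOpen_ball.mem_nhds hx, ?_, ?_⟩
    · intro y hy
      apply ContinuousAt.continuousWithinAt
      rcases root y hy with hinf | ⟨ρ, hρ, hz⟩
      · unfold ContinuousAt
        rw [(inf y hy hinf).fderiv, tendsto_zero_iff_norm_tendsto_zero, Metric.tendsto_nhds]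
        intro δ hδ
        have hsm := (hχB B).eventually_lt_const (show 0 < δ * γ / A by positivity)
        obtain ⟨K, hK⟩ := eventually_atTop.1 hsm
        filter_upwards [far y hy hinf K] with w hw
        obtain ⟨hwb, hw⟩ := hw
        rw [dist_zero_right, norm_norm]
        rcases root w hwb with hc | ⟨ρ, hρ, hz⟩
        · rw [(inf w hwb hc).fderiv, norm_zero]; exact hδ
        · refine lt_of_le_of_lt (fin w hwb ρ hρ hz).2.2 ?_
          have h7 := hK ρ (hw ρ hρ hz).le
          rw [lt_div_iff₀ hA] at h7
          calc _ = χ ρ * (exp (B * ρ) * ρ) * A / γ := by ring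
            _ < δ := by rw [div_lt_iff₀ hγ]; exact h7
      · exact (fin y hy ρ hρ hz).1.continuousAt_fderiv one_ne_zero
    · intro y hy
      rcases root y hy with hinf | ⟨ρ, hρ, hz⟩
      · exact (inf y hy hinf).differentiableAt.hasFDerivAt
      · exact ((fin y hy ρ hρ hz).1.differentiableAt one_ne_zero).hasFDerivAt
  · intro hr
    obtain ⟨ρ, hρ, hz⟩ := exists_root (hcr x) (hneg x hx) hr
    exact (fin x hx ρ hρ hz).2.1

end Aux

/-- near a 𝔷-uniform Slater point where `g` has exponential
growth, `x' ↦ e_c(x', v)` is continuously differentiable, with gradient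
`χ(ρ_c(x,v))·∇_x ρ_c(x,v)` on finite directions `F(x)` and `0` on infinite
directions `I(x)`. -/
theorem radialE_contDiffAt_gradient
    {n m p : ℕ} (hn : 0 < n) (hm : 0 < m) (hp : 0 < p)
    (𝒞 : Set (EuclideanSpace ℝ (Fin p))) (h𝒞 : MeasurableSet 𝒞)
    (z : EuclideanSpace ℝ (Fin p) → EuclideanSpace ℝ (Fin m))
    (L : EuclideanSpace ℝ (Fin p) → Matrix (Fin m) (Fin m) ℝ)
    (hz : Measurable fun c : 𝒞 => z c)
    (hL : ∀ i j, Measurable fun c : 𝒞 => L c i j)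
    (g : EuclideanSpace ℝ (Fin n) → EuclideanSpace ℝ (Fin m) → ℝ)
    (η₀ : ℝ) (hη₀ : 0 < η₀)
    (hη : ∀ c ∈ 𝒞, ‖z c‖ + ‖Matrix.toEuclideanCLM (𝕜 := ℝ) (L c)‖ ≤ η₀)
    (hg : ContDiff ℝ 1 (Function.uncurry g))
    (hconv : ∀ x, ConvexOn ℝ Set.univ (g x))
    (xbar : EuclideanSpace ℝ (Fin n))
    (hSlater : ∃ U : Set (EuclideanSpace ℝ (Fin n)), IsOpen U ∧ xbar ∈ U ∧
      ∃ γ₀ > 0, ∀ x ∈ U, ∀ c ∈ 𝒞, g x (z c) < -γ₀)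
    (hgrowth : ∃ ε > (0:ℝ), ∃ a > (0:ℝ), ∃ b > (0:ℝ), ∀ x ∈ Metric.ball xbar ε,
      ∀ w : EuclideanSpace ℝ (Fin m), ‖gradient (fun x' => g x' w) x‖ ≤ a * Real.exp (b * ‖w‖)) :
    ∃ ε > (0:ℝ), ∀ x ∈ Metric.ball xbar ε, ∀ v ∈ Metric.sphere (0 : EuclideanSpace ℝ (Fin m)) 1, ∀ c ∈ 𝒞,
      ContDiffAt ℝ 1 (fun x' => radialE g z L c x' v) x ∧
      ((∃ r > (0:ℝ), 0 < g x (z c + r • mApp (L c) v)) →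
        gradient (fun x' => radialE g z L c x' v) x =
          chiPDF m ((rho g z L c x v).toReal) •
            gradient (fun x' => (rho g z L c x' v).toReal) x) ∧
      ((∀ r > (0:ℝ), g x (z c + r • mApp (L c) v) < 0) →
        gradient (fun x' => radialE g z L c x' v) x = 0) := by
  obtain ⟨U, hU, hxU, γ, hγ, hSl⟩ := hSlater
  obtain ⟨ε₁, hε₁, a, ha, b, hb, hgr⟩ := hgrowth
  obtain ⟨ε₂, hε₂, hball⟩ := Metric.isOpen_iff.1 hU xbar hxU
  refine ⟨min ε₁ ε₂, lt_min hε₁ hε₂, ?_⟩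
  intro x hx v hv c hc
  set w := mApp (L c) v with hw
  have hwn : ‖w‖ ≤ η₀ := by
    have h1 : w = Matrix.toEuclideanCLM (𝕜 := ℝ) (L c) v := rfl
    have h2 := (Matrix.toEuclideanCLM (𝕜 := ℝ) (L c)).le_opNorm v
    rw [mem_sphere_zero_iff_norm.1 hv, mul_one, ← h1] at h2
    linarith [hη c hc, norm_nonneg (z c)]
  have hzn : ‖z c‖ ≤ η₀ := by
    linarith [hη c hc, norm_nonneg (Matrix.toEuclideanCLM (𝕜 := ℝ) (L c))]
  obtain ⟨hχc, hχ0, hχ⟩ := chi_facts hm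
  have key := main_abs (h := fun x r => g x (r • w + z c)) (xb := xbar) (ε := min ε₁ ε₂) (γ := γ)
    (A := a * Real.exp (b * η₀)) (B := b * η₀) (χ := chiPDF m)
    (R := fun x' => (rho g z L c x' v).toReal) (e := fun x' => radialE g z L c x' v) (x := x)
    ?_ ?_ hγ (by positivity) (by positivity) ?_ ?_ hχc hχ0 hχ (fun _ => rfl) (fun _ => rfl) hx
  · obtain ⟨k1, k2, k3⟩ := key
    refine ⟨k1, ?_, ?_⟩
    · rintro ⟨r, hr, hr'⟩
      have := k2 ⟨r, hr, by rw [add_comm]; exact hr'⟩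
      unfold gradient
      rw [this, map_smul]
    · intro hr
      have := k3 (fun r hr0 => by rw [add_comm]; exact (hr r hr0).le)
      unfold gradient
      rw [this, map_zero]
  · have : ContDiff ℝ 1 (fun q : EuclideanSpace ℝ (Fin n) × ℝ => (q.1, q.2 • w + z c)) := by
      fun_prop
    exact hg.comp this
  · intro x
    refine ⟨convex_univ, ?_⟩
    intro r _ s _ α β hα hβ hαβ
    have h1 := (hconv x).2 (mem_univ (r • w + z c)) (mem_univ (s • w + z c)) hα hβ hαβ
    have h2 : (α • r + β • s) • w + z c = α • (r • w + z c) + β • (s • w + z c) := by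
      have h3 : z c = (α + β) • z c := by rw [hαβ, one_smul]
      conv_lhs => rw [h3]
      simp only [smul_eq_mul]
      module
    simp only
    rw [h2]
    exact h1
  · intro y hy
    have := hSl y (hball (Metric.ball_subset_ball (min_le_right _ _) hy)) c hc
    simpa using this
  · intro y hy r hr
    have h1 := hgr y (Metric.ball_subset_ball (min_le_left _ _) hy) (r • w + z c)
    unfold gradient at h1
    rw [LinearIsometryEquiv.norm_map] at h1
    refine h1.trans ?_
    rw [mul_assoc, ← Real.exp_add]
    have h2 : ‖r • w + z c‖ ≤ r * η₀ + η₀ := by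
      refine (norm_add_le _ _).trans ?_
      rw [norm_smul, Real.norm_of_nonneg hr]
      gcongr
    have h3 : b * ‖r • w + z c‖ ≤ b * η₀ + b * η₀ * r := by nlinarith
    gcongr

end
end

section
/- Suppose x̄ is a 𝔷-uniform Slater point and g satisfies the exponential growth condition at x̄. Then there exist ε > 0 and κ̂ ≥ 0 such that for all (x, v, c) ∈ B_ε(x̄) × S^{m−1} × 𝒞, the function x' ↦ e_c(x', v) is differentiable at x and ‖∇_x e_c(x, v)‖ ≤ κ̂. -/
open MeasureTheory Real Set
open scoped InnerProductSpace ENNReal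

noncomputable section

open Filter Topology in
lemma chi_aux_bound (m k : ℕ) (B : ℝ) :
    ∃ C : ℝ, 0 ≤ C ∧ ∀ r : ℝ, 0 ≤ r → r ^ k * |chiPDF m r| ≤ C * Real.exp (-(B * r)) := by
  set c := |(2 ^ (1 - (m : ℝ) / 2) / Real.Gamma ((m : ℝ) / 2) : ℝ)| with hc
  set N := k + (m - 1) with hN
  refine ⟨c * (N.factorial * Real.exp ((B + 1) ^ 2 / 2)), by positivity, fun r hr => ?_⟩
  have h1 : r ^ N ≤ N.factorial * Real.exp r := by
    have := Real.pow_div_factorial_le_exp r hr N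
    rwa [div_le_iff₀ (by positivity), mul_comm] at this
  have h2 : r ^ k * |chiPDF m r| = c * (r ^ N * Real.exp (-r ^ 2 / 2)) := by
    unfold chiPDF
    rw [abs_mul, abs_mul, ← hc, abs_of_nonneg (pow_nonneg hr _), abs_of_pos (Real.exp_pos _), hN,
      pow_add]
    ring
  rw [h2, mul_assoc]
  refine mul_le_mul_of_nonneg_left ?_ (abs_nonneg _)
  calc r ^ N * Real.exp (-r ^ 2 / 2)
      ≤ (N.factorial * Real.exp r) * Real.exp (-r ^ 2 / 2) := by gcongr
    _ = N.factorial * Real.exp (r + -r ^ 2 / 2) := by rw [Real.exp_add]; ring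
    _ ≤ N.factorial * Real.exp ((B + 1) ^ 2 / 2 + -(B * r)) := by
        refine mul_le_mul_of_nonneg_left (Real.exp_le_exp.mpr ?_) (by positivity)
        nlinarith [sq_nonneg (r - (B + 1))]
    _ = _ := by rw [Real.exp_add]; ring

lemma chi_continuous (m : ℕ) : Continuous (chiPDF m) := by
  unfold chiPDF
  fun_prop

lemma chi_tail (m : ℕ) (B : ℝ) (hB : 0 < B) :
    ∃ C : ℝ, 0 ≤ C ∧ (∀ R : ℝ, 0 ≤ R → IntegrableOn (chiPDF m) (Ioi R) ∧
      |∫ r in Ioi R, chiPDF m r| ≤ C * Real.exp (-(B * R))) := by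
  obtain ⟨C, hC, h⟩ := chi_aux_bound m 0 B
  refine ⟨C / B, by positivity, fun R hR => ?_⟩
  have hint : IntegrableOn (fun r : ℝ => C * Real.exp (-B * r)) (Ioi R) :=
    (integrableOn_exp_mul_Ioi (by linarith : -B < 0) R).const_mul C
  have hle : ∀ᵐ r ∂(volume.restrict (Ioi R)), ‖chiPDF m r‖ ≤ C * Real.exp (-B * r) := by
    filter_upwards [ae_restrict_mem measurableSet_Ioi] with r hr
    have := h r (hR.trans (le_of_lt hr))
    simpa using this
  refine ⟨hint.mono' (chi_continuous m).aestronglyMeasurable hle, ?_⟩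
  have := norm_integral_le_of_norm_le hint hle
  rw [integral_const_mul, integral_exp_mul_Ioi (by linarith : -B < 0)] at this
  rw [← Real.norm_eq_abs]
  refine this.trans (le_of_eq ?_)
  rw [← neg_mul]
  field_simp

lemma conv_ineq {f : ℝ → ℝ} (hf : ConvexOn ℝ univ f) (r s t u : ℝ) (ht : 0 ≤ t) (hu : 0 ≤ u)
    (htu : t + u = 1) : f (t • r + u • s) ≤ t • f r + u • f s :=
  hf.2 (mem_univ r) (mem_univ s) ht hu htu

lemma sublevel_eq {f : ℝ → ℝ} (hf : ConvexOn ℝ univ f) (h0 : f 0 < 0) {ρ : ℝ} (hρ : 0 < ρ)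
    (h1 : f ρ = 0) : {r : ℝ | 0 ≤ r ∧ f r ≤ 0} = Icc 0 ρ := by
  ext r
  simp only [mem_ofPred_eq, mem_Icc]
  refine and_congr_right fun hr => ⟨fun h => ?_, fun h => ?_⟩
  · by_contra! hlt
    have hr' : 0 < r := by linarith
    have := conv_ineq hf 0 r (1 - ρ / r) (ρ / r)
      (by rw [sub_nonneg, div_le_one hr']; exact hlt.le) (by positivity) (by ring)
    have e : (1 - ρ / r) • (0:ℝ) + (ρ / r) • r = ρ := by
      simp only [smul_eq_mul]; field_simp; ring
    rw [e, h1] at this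
    simp only [smul_eq_mul] at this
    have q : ρ / r < 1 := by rw [div_lt_one hr']; exact hlt
    have q0 : 0 < ρ / r := by positivity
    nlinarith
  · have := conv_ineq hf 0 ρ (1 - r / ρ) (r / ρ)
      (by rw [sub_nonneg, div_le_one hρ]; exact h) (by positivity) (by ring)
    have e : (1 - r / ρ) • (0:ℝ) + (r / ρ) • ρ = r := by
      simp only [smul_eq_mul]; field_simp; ring
    rw [e, h1] at this
    simp only [smul_eq_mul] at this
    have q : r / ρ ≤ 1 := by rw [div_le_one hρ]; exact h
    nlinarith

lemma sublevel_cases {f : ℝ → ℝ} (hc : Continuous f) (h0 : f 0 < 0) :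
    (∀ r, 0 ≤ r → f r ≤ 0) ∨ ∃ ρ, 0 < ρ ∧ f ρ = 0 := by
  by_cases h : ∀ r, 0 ≤ r → f r ≤ 0
  · exact Or.inl h
  · right
    push Not at h
    obtain ⟨r, hr, hfr⟩ := h
    obtain ⟨ρ, hρ, hρ'⟩ := intermediate_value_Icc hr hc.continuousOn (show (0:ℝ) ∈ Icc (f 0) (f r) from ⟨h0.le, hfr.le⟩)
    refine ⟨ρ, lt_of_le_of_ne hρ.1 ?_, hρ'⟩
    rintro rfl
    linarith

open Filter Topology in
lemma core_finite {E : Type*} [NormedAddCommGroup E] [NormedSpace ℝ E] [CompleteSpace E]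
    (m : ℕ) (h : E → ℝ → ℝ) (hh : ContDiff ℝ 1 (Function.uncurry h))
    (hconv : ∀ x, ConvexOn ℝ univ (h x)) (γ A B C : ℝ) (hγ : 0 < γ) (hA : 0 < A)
    (hC : ∀ r : ℝ, 0 ≤ r → r ^ 1 * |chiPDF m r| ≤ C * Real.exp (-(B * r)))
    (x : E) (hS : ∀ᶠ x' in 𝓝 x, h x' 0 < -γ)
    (hG : ∀ r, 0 ≤ r → ‖fderiv ℝ (fun x' => h x' r) x‖ ≤ A * Real.exp (B * r))
    (ρ : ℝ) (hρ : 0 < ρ) (hρ0 : h x ρ = 0) :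
    ∃ e' : E →L[ℝ] ℝ, HasFDerivAt (fun x' => ∫ r in {r : ℝ | 0 ≤ r ∧ h x' r ≤ 0}, chiPDF m r) e' x ∧
      ‖e'‖ ≤ C * A / γ := by
  set f := Function.uncurry h with hf
  set f' := fderiv ℝ f (x, ρ) with hf'
  have hs : HasStrictFDerivAt f f' (x, ρ) := hh.contDiffAt.hasStrictFDerivAt (by norm_num)
  set d := f' (0, 1) with hd
  have hder : HasDerivAt (h x) d ρ := by
    have h1 : HasDerivAt (fun r : ℝ => ((x, r) : E × ℝ)) (0, 1) ρ :=
      (hasDerivAt_const ρ x).prodMk (hasDerivAt_id ρ)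
    exact hs.hasFDerivAt.comp_hasDerivAt ρ h1
  have hx0 : h x 0 < -γ := hS.self_of_nhds
  have hdγ : γ / ρ ≤ d := by
    have := (hconv x).slope_le_of_hasDerivAt (mem_univ 0) (mem_univ ρ) hρ hder
    refine le_trans ?_ this
    rw [slope_def_field, hρ0, sub_zero]
    gcongr
    linarith
  have hdpos : 0 < d := lt_of_lt_of_le (by positivity) hdγ
  have hinv : (f' ∘L .inr ℝ E ℝ).IsInvertible := by
    refine ⟨ContinuousLinearEquiv.unitsEquivAut ℝ (Units.mk0 d hdpos.ne'), ?_⟩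
    ext
    simp [hd]
  set ψ := hs.implicitFunctionOfProdDomain hinv with hψ
  obtain ⟨ψ', hψ'⟩ : ∃ ψ', HasFDerivAt ψ ψ' x :=
    ⟨_, (hs.hasStrictFDerivAt_implicitFunctionOfProdDomain hinv).hasFDerivAt⟩
  have hev : ∀ᶠ x' in 𝓝 x, f (x', ψ x') = 0 := by
    have := hs.eventually_apply_implicitFunctionOfProdDomain hinv
    simpa [hf, hρ0] using this
  have hT : Tendsto ψ (𝓝 x) (𝓝 ρ) := hs.tendsto_implicitFunctionOfProdDomain hinv
  have hψx : ψ x = ρ := tendsto_nhds_unique hψ'.continuousAt.tendsto hT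
  have hchain : ∀ y, f' (y, 0) + d * ψ' y = 0 := by
    have h1 : HasFDerivAt (fun x' => f (x', ψ x')) (f' ∘L ((ContinuousLinearMap.id ℝ E).prod ψ')) x := by
      refine HasFDerivAt.comp (g := f) x ?_ ((hasFDerivAt_id x).prodMk hψ')
      simpa [hψx] using hs.hasFDerivAt
    have h2 : HasFDerivAt (fun x' => f (x', ψ x')) (0 : E →L[ℝ] ℝ) x :=
      (hasFDerivAt_const (0:ℝ) x).congr_of_eventuallyEq hev
    intro y
    have h3 := congrArg (fun T : E →L[ℝ] ℝ => T y) (h1.unique h2)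
    have h4 : f' (y, ψ' y) = 0 := by simpa using h3
    have h5 : ((y, ψ' y) : E × ℝ) = (y, 0) + (ψ' y) • ((0, 1) : E × ℝ) := by simp
    rw [h5, map_add, map_smul, smul_eq_mul, ← hd] at h4
    linarith
  have hpart : HasFDerivAt (fun x' => h x' ρ) (f' ∘L (.inl ℝ E ℝ)) x := by
    have h1 : HasFDerivAt (fun x' : E => ((x', ρ) : E × ℝ)) (.inl ℝ E ℝ) x :=
      hasFDerivAt_prodMk_left x ρ
    exact hs.hasFDerivAt.comp x h1
  have hGρ := hG ρ hρ.le
  rw [hpart.fderiv] at hGρ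
  have hψn : ‖ψ'‖ ≤ ρ * (A * Real.exp (B * ρ)) / γ := by
    refine ContinuousLinearMap.opNorm_le_bound _ (by positivity) fun y => ?_
    have h1 := (f' ∘L (.inl ℝ E ℝ)).le_of_opNorm_le hGρ y
    have h2 : (f' ∘L (.inl ℝ E ℝ)) y = - (d * ψ' y) := by
      have := hchain y
      simp only [ContinuousLinearMap.comp_apply, ContinuousLinearMap.inl_apply]
      linarith
    rw [h2, norm_neg, norm_mul, Real.norm_of_nonneg hdpos.le] at h1
    have h3 : γ / ρ * ‖ψ' y‖ ≤ A * Real.exp (B * ρ) * ‖y‖ :=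
      (mul_le_mul_of_nonneg_right hdγ (norm_nonneg _)).trans h1
    rw [div_mul_eq_mul_div, div_le_iff₀ hρ] at h3
    rw [div_mul_eq_mul_div, le_div_iff₀ hγ]
    linarith
  have hF : HasDerivAt (fun t => ∫ r in (0:ℝ)..t, chiPDF m r) (chiPDF m ρ) (ψ x) := by
    rw [hψx]
    exact intervalIntegral.integral_hasDerivAt_right ((chi_continuous m).intervalIntegrable _ _)
      (chi_continuous m).stronglyMeasurable.stronglyMeasurableAtFilter (chi_continuous m).continuousAt
  refine ⟨chiPDF m ρ • ψ', ?_, ?_⟩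
  · refine (hF.comp_hasFDerivAt x hψ').congr_of_eventuallyEq ?_
    filter_upwards [hev, hS, hT.eventually (lt_mem_nhds hρ)] with x' h1 h2 h3
    rw [sublevel_eq (hconv x') (by linarith) h3 h1, Function.comp_apply,
      intervalIntegral.integral_of_le h3.le, integral_Icc_eq_integral_Ioc]
  · rw [norm_smul, Real.norm_eq_abs]
    calc |chiPDF m ρ| * ‖ψ'‖ ≤ |chiPDF m ρ| * (ρ * (A * Real.exp (B * ρ)) / γ) := by gcongr
      _ = (ρ ^ 1 * |chiPDF m ρ|) * (A * Real.exp (B * ρ)) / γ := by ring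
      _ ≤ (C * Real.exp (-(B * ρ))) * (A * Real.exp (B * ρ)) / γ := by
          refine div_le_div_of_nonneg_right ?_ hγ.le
          exact mul_le_mul_of_nonneg_right (hC ρ hρ.le) (by positivity)
      _ = C * A / γ * (Real.exp (-(B * ρ)) * Real.exp (B * ρ)) := by ring
      _ = C * A / γ := by rw [← Real.exp_add]; simp

open Filter Topology in
lemma core_infinite {E : Type*} [NormedAddCommGroup E] [NormedSpace ℝ E]
    (m : ℕ) (h : E → ℝ → ℝ) (hh : ContDiff ℝ 1 (Function.uncurry h))
    (hconv : ∀ x, ConvexOn ℝ univ (h x)) (γ A B : ℝ) (hγ : 0 < γ) (hA : 0 < A) (hB : 0 < B)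
    (x : E) (δ : ℝ) (hδ : 0 < δ) (hS : ∀ x' ∈ Metric.ball x δ, h x' 0 < -γ)
    (hG : ∀ x' ∈ Metric.ball x δ, ∀ r, 0 ≤ r →
      ‖fderiv ℝ (fun x' => h x' r) x'‖ ≤ A * Real.exp (B * r))
    (hinf : ∀ r, 0 ≤ r → h x r ≤ 0) :
    HasFDerivAt (fun x' => ∫ r in {r : ℝ | 0 ≤ r ∧ h x' r ≤ 0}, chiPDF m r) (0 : E →L[ℝ] ℝ) x := by
  obtain ⟨C, hC0, hC⟩ := chi_tail m (B * 2) (by positivity)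
  have hcont : ∀ x', Continuous (h x') := fun x' => by
    have := hh.continuous
    exact this.comp (Continuous.prodMk_right x')
  have hset : ∀ x', (∀ r, 0 ≤ r → h x' r ≤ 0) → {r : ℝ | 0 ≤ r ∧ h x' r ≤ 0} = Ici 0 := by
    intro x' hx'
    ext r
    simp only [mem_ofPred_eq, mem_Ici]
    exact ⟨fun q => q.1, fun q => ⟨q, hx' r q⟩⟩
  have hxx : x ∈ Metric.ball x δ := Metric.mem_ball_self hδ
  have key : ∀ x' ∈ Metric.ball x δ,
      ‖(∫ r in {r : ℝ | 0 ≤ r ∧ h x' r ≤ 0}, chiPDF m r) -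
        (∫ r in {r : ℝ | 0 ≤ r ∧ h x r ≤ 0}, chiPDF m r)‖ ≤ (C * (2 * A / γ) ^ 2) * ‖x' - x‖ ^ 2 := by
    intro x' hx'
    have hx0 := hS x' hx'
    rcases sublevel_cases (hcont x') (by linarith) with hcase | ⟨ρ, hρ, hρ0⟩
    · rw [hset x hinf, hset x' hcase, sub_self, norm_zero]
      positivity
    · rw [hset x hinf, sublevel_eq (hconv x') (by linarith) hρ hρ0]
      obtain ⟨hi, hb⟩ := hC ρ hρ.le
      have hsplit : (∫ r in Ici (0:ℝ), chiPDF m r) =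
          (∫ r in Icc 0 ρ, chiPDF m r) + ∫ r in Ioi ρ, chiPDF m r := by
        rw [← Icc_union_Ioi_eq_Ici hρ.le]
        refine setIntegral_union ?_ measurableSet_Ioi ?_ hi
        · rw [Set.disjoint_left]
          intro r h1 h2
          exact absurd h2 (not_lt.mpr h1.2)
        · exact (chi_continuous m).continuousOn.integrableOn_Icc
      rw [hsplit, sub_add_cancel_left, norm_neg, Real.norm_eq_abs]
      refine hb.trans ?_
      have hmid : h x ρ ≤ -γ / 2 := by
        have h1 := conv_ineq (hconv x) 0 (2 * ρ) (1 / 2) (1 / 2)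
          (by norm_num) (by norm_num) (by norm_num)
        have e : (1 / 2 : ℝ) • (0:ℝ) + (1 / 2 : ℝ) • (2 * ρ) = ρ := by
          simp only [smul_eq_mul]; ring
        rw [e] at h1
        simp only [smul_eq_mul] at h1
        have h2 := hinf (2 * ρ) (by positivity)
        have h3 := hS x hxx
        linarith
      have hmv : ‖h x' ρ - h x ρ‖ ≤ A * Real.exp (B * ρ) * ‖x' - x‖ := by
        refine Convex.norm_image_sub_le_of_norm_fderiv_le (𝕜 := ℝ) (f := fun x' => h x' ρ)
          (s := Metric.ball x δ) ?_ (fun y hy => hG y hy ρ hρ.le) (convex_ball x δ) hxx hx'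
        intro y _
        have hd : Differentiable ℝ (Function.uncurry h) := hh.differentiable (by norm_num)
        exact (hd (y, ρ)).comp y (by fun_prop : DifferentiableAt ℝ (fun y : E => ((y, ρ) : E × ℝ)) y)
      rw [hρ0] at hmv
      have h4 : γ / 2 ≤ A * Real.exp (B * ρ) * ‖x' - x‖ := by
        have := le_abs_self (0 - h x ρ)
        rw [Real.norm_eq_abs] at hmv
        linarith
      have h5 : Real.exp (-(B * ρ)) ≤ (2 * A / γ) * ‖x' - x‖ := by
        have h6 : Real.exp (-(B * ρ)) * (γ / 2) ≤ A * ‖x' - x‖ := by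
          calc Real.exp (-(B * ρ)) * (γ / 2)
              ≤ Real.exp (-(B * ρ)) * (A * Real.exp (B * ρ) * ‖x' - x‖) := by gcongr
            _ = (Real.exp (-(B * ρ)) * Real.exp (B * ρ)) * (A * ‖x' - x‖) := by ring
            _ = _ := by rw [← Real.exp_add]; simp
        rw [div_mul_eq_mul_div, le_div_iff₀ hγ]
        linarith
      have h7 : Real.exp (-(B * 2 * ρ)) = Real.exp (-(B * ρ)) ^ 2 := by
        rw [← Real.exp_nat_mul]; congr 1; push_cast; ring
      rw [h7, mul_assoc, ← mul_pow]
      gcongr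
  rw [hasFDerivAt_iff_isLittleO_nhds_zero]
  have hO : (fun y : E => (∫ r in {r : ℝ | 0 ≤ r ∧ h (x + y) r ≤ 0}, chiPDF m r) -
        (∫ r in {r : ℝ | 0 ≤ r ∧ h x r ≤ 0}, chiPDF m r) - (0 : E →L[ℝ] ℝ) y)
        =O[𝓝 0] fun y : E => ‖y‖ ^ 2 := by
    refine Asymptotics.IsBigO.of_bound (C * (2 * A / γ) ^ 2) ?_
    filter_upwards [Metric.ball_mem_nhds (0:E) hδ] with y hy
    have := key (x + y) (by simpa using hy)
    simpa using this
  refine hO.trans_isLittleO ?_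
  exact Asymptotics.isLittleO_norm_pow_id one_lt_two


/-- near a 𝔷-uniform Slater point where `g` has exponential
growth, `x' ↦ e_c(x', v)` is differentiable with uniformly bounded gradient. -/
theorem radialE_gradient_bounded
    {n m p : ℕ} (hn : 0 < n) (hm : 0 < m) (hp : 0 < p)
    (𝒞 : Set (EuclideanSpace ℝ (Fin p))) (h𝒞 : MeasurableSet 𝒞)
    (z : EuclideanSpace ℝ (Fin p) → EuclideanSpace ℝ (Fin m))
    (L : EuclideanSpace ℝ (Fin p) → Matrix (Fin m) (Fin m) ℝ)
    (hz : Measurable fun c : 𝒞 => z c)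
    (hL : ∀ i j, Measurable fun c : 𝒞 => L c i j)
    (g : EuclideanSpace ℝ (Fin n) → EuclideanSpace ℝ (Fin m) → ℝ)
    (η₀ : ℝ) (hη₀ : 0 < η₀)
    (hη : ∀ c ∈ 𝒞, ‖z c‖ + ‖Matrix.toEuclideanCLM (𝕜 := ℝ) (L c)‖ ≤ η₀)
    (hg : ContDiff ℝ 1 (Function.uncurry g))
    (hconv : ∀ x, ConvexOn ℝ Set.univ (g x))
    (xbar : EuclideanSpace ℝ (Fin n))
    (hSlater : ∃ U : Set (EuclideanSpace ℝ (Fin n)), IsOpen U ∧ xbar ∈ U ∧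
      ∃ γ₀ > 0, ∀ x ∈ U, ∀ c ∈ 𝒞, g x (z c) < -γ₀)
    (hgrowth : ∃ ε > (0:ℝ), ∃ a > (0:ℝ), ∃ b > (0:ℝ), ∀ x ∈ Metric.ball xbar ε,
      ∀ w : EuclideanSpace ℝ (Fin m), ‖gradient (fun x' => g x' w) x‖ ≤ a * Real.exp (b * ‖w‖)) :
    ∃ ε > (0:ℝ), ∃ κ : ℝ, 0 ≤ κ ∧
      ∀ x ∈ Metric.ball xbar ε, ∀ v ∈ Metric.sphere (0 : EuclideanSpace ℝ (Fin m)) 1, ∀ c ∈ 𝒞,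
        DifferentiableAt ℝ (fun x' => radialE g z L c x' v) x ∧
        ‖gradient (fun x' => radialE g z L c x' v) x‖ ≤ κ := by
  obtain ⟨U, hU, hxU, γ, hγ, hSl⟩ := hSlater
  obtain ⟨ε₁, hε₁, a, ha, b, hb, hgr⟩ := hgrowth
  obtain ⟨ε₂, hε₂, hball⟩ := Metric.isOpen_iff.mp hU xbar hxU
  obtain ⟨C, hC0, hC⟩ := chi_aux_bound m 1 (b * η₀)
  set A := a * Real.exp (b * η₀) with hA
  have hApos : 0 < A := by positivity
  have hBpos : 0 < b * η₀ := by positivity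
  refine ⟨min ε₁ ε₂, lt_min hε₁ hε₂, C * A / γ, by positivity, fun x hx v hv c hc => ?_⟩
  set h : EuclideanSpace ℝ (Fin n) → ℝ → ℝ := fun x r => g x (r • mApp (L c) v + z c) with hh
  have hhC : ContDiff ℝ 1 (Function.uncurry h) := by
    have h1 : ContDiff ℝ 1 (fun q : EuclideanSpace ℝ (Fin n) × ℝ =>
        (q.1, q.2 • mApp (L c) v + z c)) := by fun_prop
    exact hg.comp h1
  have hhconv : ∀ x, ConvexOn ℝ univ (h x) := by
    intro x
    refine ⟨convex_univ, fun r _ s _ t u ht hu htu => ?_⟩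
    have h1 := (hconv x).2 (mem_univ (r • mApp (L c) v + z c)) (mem_univ (s • mApp (L c) v + z c))
      ht hu htu
    have h2 : t • (r • mApp (L c) v + z c) + u • (s • mApp (L c) v + z c)
        = (t • r + u • s) • mApp (L c) v + z c := by
      have h3 : z c = (t + u) • z c := by rw [htu, one_smul]
      conv_rhs => rw [h3]
      simp only [smul_eq_mul]
      module
    rw [h2] at h1
    exact h1
  have hS : ∀ x' ∈ Metric.ball xbar (min ε₁ ε₂), h x' 0 < -γ := by
    intro x' hx'
    have := hSl x' (hball (Metric.ball_subset_ball (min_le_right _ _) hx')) c hc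
    simpa [hh] using this
  have hG : ∀ x' ∈ Metric.ball xbar (min ε₁ ε₂), ∀ r, 0 ≤ r →
      ‖fderiv ℝ (fun x' => h x' r) x'‖ ≤ A * Real.exp (b * η₀ * r) := by
    intro x' hx' r hr
    have h1 := hgr x' (Metric.ball_subset_ball (min_le_left _ _) hx') (r • mApp (L c) v + z c)
    rw [← toDual_gradient, LinearIsometryEquiv.norm_map]
    refine h1.trans ?_
    rw [hA, mul_assoc, ← Real.exp_add]
    have h2 : ‖mApp (L c) v‖ ≤ ‖Matrix.toEuclideanCLM (𝕜 := ℝ) (L c)‖ := by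
      have h3 := (Matrix.toEuclideanCLM (𝕜 := ℝ) (L c)).le_opNorm v
      rw [mem_sphere_zero_iff_norm.mp hv, mul_one] at h3
      exact h3
    have h4 := hη c hc
    have h5 : ‖r • mApp (L c) v + z c‖ ≤ r * η₀ + η₀ := by
      refine (norm_add_le _ _).trans ?_
      rw [norm_smul, Real.norm_of_nonneg hr]
      have h6 : ‖mApp (L c) v‖ ≤ η₀ := by linarith [norm_nonneg (z c)]
      have h7 : ‖z c‖ ≤ η₀ := by
        linarith [norm_nonneg (Matrix.toEuclideanCLM (𝕜 := ℝ) (L c))]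
      gcongr
    gcongr
    nlinarith
  have hE : (fun x' => radialE g z L c x' v) =
      fun x' => ∫ r in {r : ℝ | 0 ≤ r ∧ h x' r ≤ 0}, chiPDF m r := rfl
  have main : ∃ e' : EuclideanSpace ℝ (Fin n) →L[ℝ] ℝ,
      HasFDerivAt (fun x' => radialE g z L c x' v) e' x ∧ ‖e'‖ ≤ C * A / γ := by
    rw [hE]
    have hcx : Continuous (h x) := hhC.continuous.comp (Continuous.prodMk_right x)
    rcases sublevel_cases hcx (by linarith [hS x hx]) with hinf | ⟨ρ, hρ, hρ0⟩
    · obtain ⟨δ, hδ, hδb⟩ := Metric.isOpen_iff.mp Metric.isOpen_ball x hx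
      refine ⟨0, core_infinite m h hhC hhconv γ A (b * η₀) hγ hApos hBpos x δ hδ
        (fun y hy => hS y (hδb hy)) (fun y hy => hG y (hδb hy)) hinf, ?_⟩
      rw [norm_zero]
      positivity
    · refine core_finite m h hhC hhconv γ A (b * η₀) C hγ hApos hC x ?_ (hG x hx) ρ hρ hρ0
      filter_upwards [Metric.isOpen_ball.mem_nhds hx] with y hy using hS y hy
  obtain ⟨e', he', hn'⟩ := main
  refine ⟨he'.differentiableAt, ?_⟩
  rw [← LinearIsometryEquiv.norm_map (InnerProductSpace.toDual ℝ (EuclideanSpace ℝ (Fin n))),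
    toDual_gradient, he'.fderiv]
  exact hn'

end
end
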